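/- Let g = 1, so H = ℚx ⊕ ℚy with ω(x,y)=1. For m ∈ ℤ let W_m(H^{⊗n}) denote the span of the basis tensors (in the letters x, y) in which the number of factors equal to x minus the number of factors equal to y is m, and for each k regard h_{1,1}(k) as a subspace of H^{⊗(k+2)}. Then: (a) h_{1,1}(k) = 0 for k = 1, 3, 5; (b) for every even k ≥ 2, h_{1,1}(k) ∩ W_m(H^{⊗(k+2)}) = 0 for all m > k−2 and dim_ℚ ( h_{1,1}(k) ∩ W_{k−2}(H^{⊗(k+2)}) ) = 1; (c) for every odd k ≥ 7, h_{1,1}(k) ∩ W_m(H^{⊗(k+2)}) = 0 for all m > k−4 and dim_ℚ ( h_{1,1}(k) ∩ W_{k−4}(H^{⊗(k+2)}) ) = ⌊k/6⌋. (Equivalently, as an SL(2,ℚ)-module the leading term of h_{1,1}(k) is [k−2] with multiplicity 1 for k even, and ⌊k/6⌋·[k−4] for odd k ≥ 7.) -/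

import Mathlib

noncomputable section

open Finset

/-! ## The symplectic vector space `H = ℚ^{2g}` and its tensor powers -/

/-- `H_g = ℚ^{2g}`, with symplectic basis `x_1, y_1, …, x_g, y_g`
(`x_i` at index `2(i-1)`, `y_i` at index `2(i-1)+1`). -/
abbrev HH (g : ℕ) := Fin (2*g) → ℚ

/-- The tensor power `H^{⊗m}`, modelled as coefficient functions on words in the basis. -/
abbrev Tens (g m : ℕ) := (Fin m → Fin (2*g)) → ℚ

/-- index of `x_i` -/
def xI {g : ℕ} (i : Fin g) : Fin (2*g) := ⟨2*i.val, by have := i.isLt; omega⟩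
/-- index of `y_i` -/
def yI {g : ℕ} (i : Fin g) : Fin (2*g) := ⟨2*i.val+1, by have := i.isLt; omega⟩

/-- standard basis vectors of `HH g` -/
def stdB (g : ℕ) (a : Fin (2*g)) : HH g := fun b => if b = a then 1 else 0

/-- the symplectic form `ω` on `HH g` -/
def omegaF {g : ℕ} (u v : HH g) : ℚ :=
  ∑ i : Fin g, (u (xI i) * v (yI i) - u (yI i) * v (xI i))

/-- `ω(e_a , e_b)` on basis vectors -/
def omegaB (g : ℕ) (a b : Fin (2*g)) : ℚ := omegaF (stdB g a) (stdB g b)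

/-- the pure tensor `u ⊗ ξ` -/
def oneTmul {g m : ℕ} (u : HH g) (ξ : Tens g m) : Tens g (m+1) :=
  fun w => u (w 0) * ξ (fun i => w i.succ)

/-- the bracket `[u, ξ] = u ⊗ ξ - ξ ⊗ u` in the tensor algebra -/
def oneBrkt {g m : ℕ} (u : HH g) (ξ : Tens g m) : Tens g (m+1) :=
  fun w => u (w 0) * ξ (fun i => w i.succ)
    - ξ (fun i => w i.castSucc) * u (w (Fin.last m))

/-- left-normed Lie bracket `[u 0, [u 1, [… , u m]…]]` -/
def leftNormed (g : ℕ) : (m : ℕ) → (Fin (m+1) → HH g) → Tens g (m+1)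
  | 0, u => fun w => u 0 (w 0)
  | (m+1), u => oneBrkt (u 0) (leftNormed g m (fun i => u i.succ))

/-- `L_{g,1}(m+1)`: the degree `m+1` part of the free Lie algebra on `HH g`,
i.e. the span of the left-normed brackets, inside `H^{⊗(m+1)}`. -/
def Lsub (g m : ℕ) : Submodule ℚ (Tens g (m+1)) :=
  Submodule.span ℚ (Set.range (leftNormed g m))

/-- the linear extension of `u ⊗ ξ ↦ u ⊗ ξ - ξ ⊗ u` to all of `H^{⊗(m+1)}` -/
def betaFun {g m : ℕ} (t : Tens g (m+1)) : Tens g (m+1) :=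
  fun w => t w - t (fun i => Fin.cases (w (Fin.last m)) (fun j => w j.castSucc) i)

/-- `betaFun` as a linear map -/
def betaL (g m : ℕ) : Tens g (m+1) →ₗ[ℚ] Tens g (m+1) where
  toFun := betaFun
  map_add' a b := by funext w; simp only [betaFun, Pi.add_apply]; ring
  map_smul' c a := by
    funext w
    simp only [betaFun, Pi.smul_apply, smul_eq_mul, RingHom.id_apply]
    ring

/-- `H ⊗ L_{g,1}(k+1)` inside `H^{⊗(k+2)}` -/
def HLsub (g k : ℕ) : Submodule ℚ (Tens g (k+2)) :=
  Submodule.span ℚ {t | ∃ (u : HH g) (ξ : Tens g (k+1)), ξ ∈ Lsub g k ∧ t = oneTmul u ξ}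

/-- `h_{g,1}(k) = Ker ([·,·] : H ⊗ L_{g,1}(k+1) → L_{g,1}(k+2))`,
as a subspace of `H^{⊗(k+2)}`. -/
def hgl (g k : ℕ) : Submodule ℚ (Tens g (k+2)) :=
  HLsub g k ⊓ LinearMap.ker (betaL g (k+1))

/-- the symplectic group `Sp(2g,ℚ)`: linear automorphisms preserving `ω` -/
def SpSet (g : ℕ) : Set (HH g ≃ₗ[ℚ] HH g) :=
  {f | ∀ u v : HH g, omegaF (f u) (f v) = omegaF u v}

/-- the diagonal action of a map `f : H → H` on `H^{⊗m}` -/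
def tensMapF {g m : ℕ} (f : HH g → HH g) (t : Tens g m) : Tens g m :=
  fun w' => ∑ w : Fin m → Fin (2*g), t w * ∏ i, f (stdB g (w i)) (w' i)

/-- the subspace of `Sp(2g,ℚ)`-invariant tensors in `H^{⊗m}` -/
def spInv (g m : ℕ) : Submodule ℚ (Tens g m) where
  carrier := {t | ∀ f : HH g ≃ₗ[ℚ] HH g, f ∈ SpSet g → tensMapF (⇑f) t = t}
  add_mem' := by
    intro a b ha hb f hf
    have h : tensMapF (⇑f) (a + b) = tensMapF (⇑f) a + tensMapF (⇑f) b := by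
      funext w'
      simp only [tensMapF, Pi.add_apply, add_mul]
      rw [Finset.sum_add_distrib]
    rw [Set.mem_setOf_eq] at *
    rw [h, ha f hf, hb f hf]
  zero_mem' := by
    intro f hf
    funext w'
    simp [tensMapF]
  smul_mem' := by
    intro c a ha f hf
    have h : tensMapF (⇑f) (c • a) = c • tensMapF (⇑f) a := by
      funext w'
      simp only [tensMapF, Pi.smul_apply, smul_eq_mul, Finset.mul_sum]
      exact Finset.sum_congr rfl fun w _ => by ring
    rw [h, ha f hf]

/-- the `Sp`-invariant part `h_{g,1}(k)^{Sp}` -/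
def hSp (g k : ℕ) : Submodule ℚ (Tens g (k+2)) := hgl g k ⊓ spInv g (k+2)

/-- the symmetric bilinear form `μ^{⊗m}` on `H^{⊗m}` -/
def muF {g m : ℕ} (ξ η : Tens g m) : ℚ :=
  ∑ w : Fin m → Fin (2*g), ∑ w' : Fin m → Fin (2*g),
    ξ w * η w' * ∏ i, omegaB g (w i) (w' i)

/-! ## Weight subspaces in genus one -/

/-- the weight of a basis word in the letters `x = e_0`, `y = e_1` of `H_1` -/
def wtW {n : ℕ} (w : Fin n → Fin (2*1)) : ℤ :=
  ∑ i, (if (w i).val = 0 then (1:ℤ) else -1)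

/-- `W_m(H^{⊗n})`: the span of the basis tensors of weight `m` -/
def wsub (m : ℤ) (n : ℕ) : Submodule ℚ (Tens 1 n) where
  carrier := {t | ∀ w : Fin n → Fin (2*1), wtW w ≠ m → t w = 0}
  add_mem' := by
    intro a b ha hb w hw
    simp only [Pi.add_apply]
    rw [ha w hw, hb w hw]; ring
  zero_mem' := by intro w _; rfl
  smul_mem' := by
    intro c a ha w hw
    simp only [Pi.smul_apply, smul_eq_mul]
    rw [ha w hw]; ring

/-! ## A polynomial with two antisymmetries -/

section Antisymmetry

open Polynomial

theorem odd_natDegree_of_comp_eq_neg {P : ℚ[X]} (hP : P ≠ 0) (hcomp : P.comp (-1 - X) = -P) :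
    Odd P.natDegree := by
  have hq : (-1 - X : ℚ[X]) = -(X + C 1) := by simp; ring
  have h := congrArg leadingCoeff hcomp
  rw [leadingCoeff_comp (by rw [hq, natDegree_neg, natDegree_X_add_C]; exact one_ne_zero), hq,
    leadingCoeff_neg, leadingCoeff_neg, leadingCoeff_X_add_C] at h
  have hlc : P.leadingCoeff ≠ 0 := leadingCoeff_ne_zero.2 hP
  by_contra hodd
  rw [(Nat.not_odd_iff_even.1 hodd).neg_one_pow, mul_one] at h
  exact hlc (self_eq_neg.1 h)

theorem eval_one_eq_zero_of_coeff_antisymm {P : ℚ[X]} {d : ℕ} (hdeg : P.natDegree ≤ d)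
    (hanti : ∀ i ≤ d, P.coeff (d - i) = -P.coeff i) : P.eval 1 = 0 := by
  have h₁ : P.eval 1 = ∑ i ∈ Finset.range (d + 1), P.coeff i := by
    rw [eval_eq_sum_range' (Nat.lt_succ_of_le hdeg)]
    simp
  have h₂ := Finset.sum_range_reflect P.coeff (d + 1)
  rw [Finset.sum_congr rfl fun i hi => by
    rw [Nat.add_sub_cancel, hanti i (Nat.lt_succ_iff.1 (Finset.mem_range.1 hi))],
    Finset.sum_neg_distrib] at h₂
  rw [h₁]
  linarith

/-- A polynomial that is antisymmetric under `X ↦ -1 - X` and under reversal of its coefficients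
vanishes as soon as about a sixth of its coefficients do. -/
theorem eq_zero_of_coeff_antisymm_of_comp_eq_neg {P : ℚ[X]} {d N : ℕ} (hdeg : P.natDegree ≤ d)
    (hd : Even d) (hanti : ∀ i ≤ d, P.coeff (d - i) = -P.coeff i)
    (hcomp : P.comp (-1 - X) = -P) (hcoeff : ∀ i < N, P.coeff (2 * i + 1) = 0)
    (hdN : d < 6 * N + 6) : P = 0 := by
  by_contra hP
  obtain ⟨e, he⟩ := odd_natDegree_of_comp_eq_neg hP hcomp
  obtain ⟨d', rfl⟩ := hd
  have hD : 2 * N + 1 ≤ d' + d' - P.natDegree := by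
    by_contra! hlt
    have h := hcoeff ((d' + d' - P.natDegree) / 2) (by omega)
    rw [show 2 * ((d' + d' - P.natDegree) / 2) + 1 = d' + d' - P.natDegree by omega,
      hanti _ hdeg, neg_eq_zero] at h
    exact hP (leadingCoeff_eq_zero.1 h)
  have hX : X ^ (2 * N + 1) ∣ P := by
    refine X_pow_dvd_iff.2 fun j hj => ?_
    have h := hanti j (by omega)
    rw [coeff_eq_zero_of_natDegree_lt (by omega)] at h
    exact neg_eq_zero.1 h.symm
  have hX' : (-1 - X) ^ (2 * N + 1) ∣ P := by
    obtain ⟨Q, hQ⟩ := hX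
    rw [← dvd_neg, ← hcomp, hQ, mul_comp, pow_comp, X_comp]
    exact dvd_mul_right _ _
  have h1 : P.eval 1 = 0 := eval_one_eq_zero_of_coeff_antisymm hdeg hanti
  have h2 : P.eval (-2) = 0 := by
    have h := congrArg (eval 1) hcomp
    rw [eval_comp, eval_neg, h1] at h
    norm_num at h
    exact h
  have hd1 : (X - C 1) ∣ P := dvd_iff_isRoot.2 h1
  have hd2 : (X - C (-2)) ∣ P := dvd_iff_isRoot.2 h2
  have c₁ : IsCoprime (X : ℚ[X]) (-1 - X) := ⟨-1, -1, by ring⟩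
  have c₂ : IsCoprime (X : ℚ[X]) (X - C 1) := ⟨1, -1, by simp⟩
  have c₃ : IsCoprime (-1 - X : ℚ[X]) (X - C 1) :=
    ⟨C (-1 / 2), C (-1 / 2), by
      rw [show (-1 - X : ℚ[X]) = -C 1 - X by simp, show (1 : ℚ[X]) = C (-1 / 2) * C (-2) by
        rw [← C_mul]; norm_num, show (C (-2) : ℚ[X]) = -C 1 - C 1 by rw [← C_neg, ← C_sub]; norm_num]
      ring⟩
  have c₄ : IsCoprime (X : ℚ[X]) (X - C (-2)) := by
    simpa using isCoprime_X_sub_C_of_isUnit_sub (a := (0 : ℚ)) (b := -2) (by norm_num)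
  have c₅ : IsCoprime (-1 - X : ℚ[X]) (X - C (-2)) :=
    ⟨1, 1, by rw [C_neg, map_ofNat C 2]; ring⟩
  have c₆ : IsCoprime (X - C 1 : ℚ[X]) (X - C (-2)) :=
    isCoprime_X_sub_C_of_isUnit_sub (by norm_num)
  have hdvd : X ^ (2 * N + 1) * (-1 - X) ^ (2 * N + 1) * (X - C 1) * (X - C (-2)) ∣ P := by
    refine IsCoprime.mul_dvd ?_ (IsCoprime.mul_dvd ?_ (IsCoprime.mul_dvd ?_ hX hX') hd1) hd2
    · exact ((c₄.pow_left).mul_left c₅.pow_left).mul_left c₆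
    · exact (c₂.pow_left).mul_left c₃.pow_left
    · exact c₁.pow
  have hle := natDegree_le_of_dvd hdvd hP
  have hq : (-1 - X : ℚ[X]) = -(X + C 1) := by simp; ring
  have n₁ : (X : ℚ[X]) ^ (2 * N + 1) ≠ 0 := pow_ne_zero _ X_ne_zero
  have n₂ : (-1 - X : ℚ[X]) ^ (2 * N + 1) ≠ 0 :=
    pow_ne_zero _ (by rw [hq]; exact neg_ne_zero.2 (X_add_C_ne_zero 1))
  rw [natDegree_mul (mul_ne_zero (mul_ne_zero n₁ n₂) (X_sub_C_ne_zero 1)) (X_sub_C_ne_zero _),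
    natDegree_mul (mul_ne_zero n₁ n₂) (X_sub_C_ne_zero 1), natDegree_mul n₁ n₂, natDegree_X_pow,
    natDegree_pow, natDegree_X_sub_C, natDegree_X_sub_C, hq, natDegree_neg, natDegree_X_add_C]
    at hle
  omega

end Antisymmetry

/-! ## Arrays satisfying the linear relations between coefficients -/

section Arrays

theorem choose_succ_mul_shift (p s : ℕ) :
    ((s + 1 : ℕ) : ℚ) * ((p + (s + 1)).choose (s + 1) : ℕ) =
      (p + 1) * ((p + 1 + s).choose s : ℕ) := by
  have h := Nat.choose_succ_right_eq (p + 1 + s) s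
  rw [Nat.add_sub_cancel] at h
  rw [show p + (s + 1) = p + 1 + s by ring, ← Nat.cast_mul, mul_comm, h]
  push_cast
  ring

/-- The middle index of an array satisfying the three-term relation can be eliminated. -/
theorem array_eq_sum_antidiagonal {g : ℕ → ℕ → ℕ → ℚ}
    (hrel : ∀ i j l : ℕ,
      (i + 1) * g (i + 1) j l + (j + 1) * g i (j + 1) l + (l + 1) * g i j (l + 1) = 0)
    (p q r : ℕ) : g p q r = (-1) ^ q * ∑ x ∈ antidiagonal q,
      ((p + x.1).choose x.1 : ℚ) * ((r + x.2).choose x.2 : ℚ) * g (p + x.1) 0 (r + x.2) := by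
  induction q generalizing p r with
  | zero => simp
  | succ q ih =>
    set T : ℕ × ℕ → ℚ := fun x =>
      ((p + x.1).choose x.1 : ℚ) * ((r + x.2).choose x.2 : ℚ) * g (p + x.1) 0 (r + x.2) with hT
    have h₁ : ∑ x ∈ antidiagonal (q + 1), (x.1 : ℚ) * T x = (p + 1) * ∑ x ∈ antidiagonal q,
        ((p + 1 + x.1).choose x.1 : ℚ) * ((r + x.2).choose x.2 : ℚ) *
          g (p + 1 + x.1) 0 (r + x.2) := by
      rw [Finset.Nat.sum_antidiagonal_succ, Finset.mul_sum]
      simp only [Nat.cast_zero, zero_mul, zero_add, hT]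
      refine Finset.sum_congr rfl fun x _ => ?_
      have h := choose_succ_mul_shift p x.1
      rw [show p + (x.1 + 1) = p + 1 + x.1 by ring] at h ⊢
      linear_combination ((r + x.2).choose x.2 : ℚ) * g (p + 1 + x.1) 0 (r + x.2) * h
    have h₂ : ∑ x ∈ antidiagonal (q + 1), (x.2 : ℚ) * T x = (r + 1) * ∑ x ∈ antidiagonal q,
        ((p + x.1).choose x.1 : ℚ) * ((r + 1 + x.2).choose x.2 : ℚ) *
          g (p + x.1) 0 (r + 1 + x.2) := by
      rw [Finset.Nat.sum_antidiagonal_succ', Finset.mul_sum]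
      simp only [Nat.cast_zero, zero_mul, zero_add, hT]
      refine Finset.sum_congr rfl fun x _ => ?_
      have h := choose_succ_mul_shift r x.2
      rw [show r + (x.2 + 1) = r + 1 + x.2 by ring] at h ⊢
      linear_combination ((p + x.1).choose x.1 : ℚ) * g (p + x.1) 0 (r + 1 + x.2) * h
    have h₃ : ((q : ℚ) + 1) * ∑ x ∈ antidiagonal (q + 1), T x =
        ∑ x ∈ antidiagonal (q + 1), (x.1 : ℚ) * T x +
          ∑ x ∈ antidiagonal (q + 1), (x.2 : ℚ) * T x := by
      rw [Finset.mul_sum, ← Finset.sum_add_distrib]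
      refine Finset.sum_congr rfl fun x hx => ?_
      rw [← add_mul]
      congr 1
      exact_mod_cast (mem_antidiagonal.1 hx).symm
    have h := hrel p q r
    rw [ih (p + 1) r, ih p (r + 1)] at h
    have hq : (q : ℚ) + 1 ≠ 0 := by positivity
    refine mul_left_cancel₀ hq ?_
    rw [mul_left_comm, h₃, h₁, h₂, pow_succ]
    linear_combination h

open Polynomial in
/-- The array of coefficients of a cyclically symmetric Lie element in words with three letters `b`
is determined by few of its entries. -/
theorem array_eq_zero {g : ℕ → ℕ → ℕ → ℚ} {d N : ℕ} (hd : Even d)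
    (hrel : ∀ i j l : ℕ,
      (i + 1) * g (i + 1) j l + (j + 1) * g i (j + 1) l + (l + 1) * g i j (l + 1) = 0)
    (hrev : ∀ i j l, i + j + l = d → g l j i = -g i j l)
    (hcyc : ∀ i l, i + l = d → g 0 l i = g i 0 l)
    (hN : ∀ i < N, ∀ l, 2 * i + 1 + l = d → g (2 * i + 1) 0 l = 0) (hdN : d < 6 * N + 6)
    {p q r : ℕ} (hpqr : p + q + r = d) : g p q r = 0 := by
  set τ : ℕ → ℚ := fun i => g i 0 (d - i) with hτ
  have hsign : ∀ i ≤ d, (-1 : ℚ) ^ (d - i) = (-1) ^ i := by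
    intro i hi
    have h : (-1 : ℚ) ^ (d - i) * (-1) ^ i = 1 := by
      rw [← pow_add, Nat.sub_add_cancel hi, hd.neg_one_pow]
    rcases neg_one_pow_eq_or ℚ i with h' | h' <;> rw [h'] at h ⊢ <;> linarith
  have hτrev : ∀ i ≤ d, τ (d - i) = -τ i := by
    intro i hi
    have h := hrev i 0 (d - i) (by omega)
    simpa [hτ, Nat.sub_sub_self hi] using h
  have hτsum : ∀ i ≤ d, (-1) ^ i * τ i = -∑ j ∈ range (d + 1), τ j * (j.choose i : ℚ) := by
    intro i hi
    have h := hcyc i (d - i) (by omega)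
    rw [array_eq_sum_antidiagonal hrel, ← Finset.Nat.sum_antidiagonal_swap,
      Finset.Nat.sum_antidiagonal_eq_sum_range_succ_mk] at h
    rw [hsign i hi] at h
    have hsq : (-1 : ℚ) ^ i * (-1) ^ i = 1 := by rw [← mul_pow]; simp
    rw [show τ i = g i 0 (d - i) from rfl, ← h, ← mul_assoc, hsq, one_mul, ← Finset.sum_neg_distrib,
      show range (d + 1) = Finset.Ico 0 (d + 1) from Finset.range_eq_Ico _,
      ← Finset.sum_Ico_consecutive _ (Nat.zero_le i) (by omega : i ≤ d + 1),
      Finset.sum_eq_zero (s := Finset.Ico 0 i), zero_add, Finset.sum_Ico_eq_sum_range,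
      show d + 1 - i = (d - i).succ by omega]
    · refine Finset.sum_congr rfl fun s hs => ?_
      have hs' : i + s ≤ d := by have := Finset.mem_range.1 hs; omega
      have h' := hτrev (i + s) hs'
      rw [show d - (i + s) = d - i - s by omega] at h'
      have e : τ (d - i - s) = g (0 + (d - i - s)) 0 (i + s) := by
        simp only [hτ, zero_add]
        congr 1
        omega
      simp only [Prod.swap]
      rw [← e, h', zero_add, Nat.choose_self, Nat.choose_symm_add]
      push_cast
      ring
    · intro j hj
      rw [Nat.choose_eq_zero_of_lt (Finset.mem_Ico.1 hj).2]
      simp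
  set P : ℚ[X] := ∑ i ∈ range (d + 1), C ((-1) ^ i * τ i) * X ^ i with hP
  have hcoeff : ∀ i, P.coeff i = if i ≤ d then (-1) ^ i * τ i else 0 := by
    intro i
    simp only [hP, finsetSum_coeff, coeff_C_mul, coeff_X_pow, mul_ite, mul_one, mul_zero,
      Finset.sum_ite_eq, Finset.mem_range, Nat.lt_succ_iff]
  have hcomp : P.comp (-1 - X) = ∑ j ∈ range (d + 1), C (τ j) * (1 + X) ^ j := by
    rw [hP, Polynomial.sum_comp]
    refine Finset.sum_congr rfl fun j _ => ?_
    rw [mul_comp, C_comp, pow_comp, X_comp, show (-1 - X : ℚ[X]) = C (-1) * (1 + X) by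
      rw [C_neg, C_1]; ring, mul_pow, ← C_pow, ← mul_assoc, ← C_mul, mul_right_comm, ← mul_pow]
    simp
  have hPzero : P = 0 := by
    refine eq_zero_of_coeff_antisymm_of_comp_eq_neg (d := d) (N := N) ?_ hd ?_ ?_ ?_ hdN
    · refine natDegree_le_iff_coeff_eq_zero.2 fun i hi => ?_
      rw [hcoeff, if_neg (by omega)]
    · intro i hi
      rw [hcoeff, hcoeff, if_pos (Nat.sub_le d i), if_pos hi, hτrev i hi, hsign i hi,
        mul_neg]
    · ext i
      rw [hcomp, coeff_neg, hcoeff, finsetSum_coeff]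
      simp only [coeff_C_mul, coeff_one_add_X_pow]
      split_ifs with hi
      · rw [hτsum i hi, neg_neg]
      · rw [neg_zero]
        refine Finset.sum_eq_zero fun j hj => ?_
        rw [Nat.choose_eq_zero_of_lt (by have := Finset.mem_range.1 hj; omega)]
        simp
    · intro i hi
      rw [hcoeff]
      split_ifs with h
      · rw [show τ (2 * i + 1) = 0 from hN i hi _ (by omega), mul_zero]
      · rfl
  have hτzero : ∀ i ≤ d, τ i = 0 := by
    intro i hi
    have h := hcoeff i
    rw [hPzero, coeff_zero, if_pos hi] at h
    exact (mul_eq_zero.1 h.symm).resolve_left (pow_ne_zero _ (by norm_num))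
  rw [array_eq_sum_antidiagonal hrel, Finset.sum_eq_zero, mul_zero]
  intro x hx
  have hx' := mem_antidiagonal.1 hx
  have h := hτzero (p + x.1) (by omega)
  simp only [hτ, show d - (p + x.1) = r + x.2 by omega] at h
  rw [h, mul_zero]

end Arrays

/-! ## Noncommutative polynomials and Lie elements -/

/-- Noncommutative polynomials over `ℚ` in the letters `α`. -/
abbrev NCPoly (α : Type*) := MonoidAlgebra ℚ (FreeMonoid α)

namespace NCPoly

attribute [local instance] LieRing.ofAssociativeRing

variable {α : Type*}

/-- A letter as a noncommutative polynomial. -/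
def letter (a : α) : NCPoly α := MonoidAlgebra.single (FreeMonoid.of a) 1

/-- The coefficient of a word, as a linear functional. -/
def cf (l : List α) : NCPoly α →ₗ[ℚ] ℚ where
  toFun f := f.coeff (FreeMonoid.ofList l)
  map_add' _ _ := by simp
  map_smul' _ _ := by simp

theorem cf_letter [DecidableEq α] (a : α) (l : List α) : cf l (letter a) = if l = [a] then 1 else 0 := by
  change (MonoidAlgebra.single (FreeMonoid.of a) (1 : ℚ)).coeff (FreeMonoid.ofList l) = _
  classical
  rw [MonoidAlgebra.coeff_single, Finsupp.single_apply]
  exact if_congr (eq_comm (a := [a])) rfl rfl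

@[simp] theorem cf_nil_letter_mul (a : α) (f : NCPoly α) : cf [] (letter a * f) = 0 := by
  refine MonoidAlgebra.coeff_single_mul_of_forall_mul_ne _ _ fun d hd => ?_
  exact List.cons_ne_nil a d.toList hd

@[simp] theorem cf_cons_letter_mul [DecidableEq α] (a c : α) (l : List α) (f : NCPoly α) :
    cf (c :: l) (letter a * f) = if c = a then cf l f else 0 := by
  split_ifs with h
  · subst h
    refine (MonoidAlgebra.coeff_single_mul_eq_mul_coeff (FreeMonoid.ofList l) fun m _ => ?_).trans
      (one_mul _)
    change c :: m.toList = c :: l ↔ m.toList = l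
    simp
  · refine MonoidAlgebra.coeff_single_mul_of_forall_mul_ne _ _ fun d hd => ?_
    exact h (List.cons_eq_cons.1 (show a :: d.toList = c :: l from hd)).1.symm

@[simp] theorem cf_nil_mul_letter (a : α) (f : NCPoly α) : cf [] (f * letter a) = 0 := by
  refine MonoidAlgebra.coeff_mul_single_of_forall_mul_ne _ _ fun d hd => ?_
  exact List.append_ne_nil_of_right_ne_nil d.toList (List.cons_ne_nil a []) hd

@[simp] theorem cf_concat_mul_letter [DecidableEq α] (a c : α) (l : List α) (f : NCPoly α) :
    cf (l ++ [c]) (f * letter a) = if c = a then cf l f else 0 := by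
  split_ifs with h
  · subst h
    refine (MonoidAlgebra.coeff_mul_single_eq_coeff_mul (FreeMonoid.ofList l) fun m _ => ?_).trans
      (mul_one _)
    change m.toList ++ [c] = l ++ [c] ↔ m.toList = l
    simp
  · refine MonoidAlgebra.coeff_mul_single_of_forall_mul_ne _ _ fun d hd => ?_
    have := congrArg List.getLast? (show d.toList ++ [a] = l ++ [c] from hd)
    simp at this
    exact h this.symm

/-- Lie elements of degree `n + 1`, spanned by the iterated brackets of letters. -/
def lieDeg (α : Type*) : ℕ → Submodule ℚ (NCPoly α)
  | 0 => Submodule.span ℚ (Set.range letter)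
  | n + 1 => Submodule.span ℚ {f | ∃ a : α, ∃ ξ : NCPoly α, ξ ∈ lieDeg α n ∧ f = ⁅letter a, ξ⁆}

theorem letter_mem_lieDeg (a : α) : letter a ∈ lieDeg α 0 :=
  Submodule.subset_span ⟨a, rfl⟩

theorem letter_lie_mem_lieDeg {n : ℕ} (a : α) {ξ : NCPoly α} (hξ : ξ ∈ lieDeg α n) :
    ⁅letter a, ξ⁆ ∈ lieDeg α (n + 1) :=
  Submodule.subset_span ⟨a, ξ, hξ, rfl⟩

/-- Induction along left-normed brackets for properties that are closed under linear combinations. -/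
theorem lieDeg_induction {P : ℕ → NCPoly α → Prop}
    (zero : ∀ n, P n 0) (add : ∀ n f g, P n f → P n g → P n (f + g))
    (smul : ∀ n (c : ℚ) f, P n f → P n (c • f)) (letter : ∀ a, P 0 (letter a))
    (lie : ∀ (n : ℕ) (a : α) (ξ : NCPoly α), ξ ∈ lieDeg α n → P n ξ → P (n + 1) ⁅NCPoly.letter a, ξ⁆) :
    ∀ {n : ℕ} {f : NCPoly α}, f ∈ lieDeg α n → P n f := by
  intro n
  induction n with
  | zero =>
    intro f hf
    refine Submodule.span_induction ?_ (zero 0) (fun f g _ _ => add 0 f g)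
      (fun c f _ => smul 0 c f) hf
    rintro _ ⟨a, rfl⟩
    exact letter a
  | succ n ih =>
    intro f hf
    refine Submodule.span_induction ?_ (zero _) (fun f g _ _ => add _ f g)
      (fun c f _ => smul _ c f) hf
    rintro _ ⟨a, ξ, hξ, rfl⟩
    exact lie n a ξ hξ (ih hξ)

theorem lie_mem_lieDeg {m n : ℕ} {f g : NCPoly α} (hf : f ∈ lieDeg α m) (hg : g ∈ lieDeg α n) :
    ⁅f, g⁆ ∈ lieDeg α (m + n + 1) := by
  refine lieDeg_induction
    (P := fun m f => ∀ n, ∀ g ∈ lieDeg α n, ⁅f, g⁆ ∈ lieDeg α (m + n + 1))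
    ?_ ?_ ?_ ?_ ?_ hf n g hg
  · intro m n g _
    simp
  · intro m f f' hf hf' n g hg
    rw [add_lie]
    exact add_mem (hf n g hg) (hf' n g hg)
  · intro m c f hf n g hg
    rw [smul_lie]
    exact Submodule.smul_mem _ _ (hf n g hg)
  · intro a n g hg
    rw [Nat.zero_add]
    exact letter_lie_mem_lieDeg a hg
  · intro m a ξ hξ ih n g hg
    rw [lie_lie]
    refine sub_mem ?_ ?_
    · have := letter_lie_mem_lieDeg a (ih n g hg)
      rwa [show m + n + 1 + 1 = m + 1 + n + 1 by ring] at this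
    · have := ih (n + 1) _ (letter_lie_mem_lieDeg a hg)
      rwa [show m + (n + 1) + 1 = m + 1 + n + 1 by ring] at this

/-- Noncommutative polynomials in which every monomial has exactly `c` letters `b`. -/
def countSub [DecidableEq α] (b : α) (c : ℕ) : Submodule ℚ (NCPoly α) where
  carrier := {f | ∀ l : List α, l.count b ≠ c → cf l f = 0}
  add_mem' hf hg l hl := by rw [map_add, hf l hl, hg l hl, add_zero]
  zero_mem' l _ := map_zero _
  smul_mem' r f hf l hl := by rw [map_smul, hf l hl, smul_zero]

theorem mul_mem_countSub [DecidableEq α] {b : α} {c d : ℕ} {f g : NCPoly α}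
    (hf : f ∈ countSub b c) (hg : g ∈ countSub b d) : f * g ∈ countSub b (c + d) := by
  classical
  intro l hl
  by_contra h
  have hmem : FreeMonoid.ofList l ∈ (f * g).coeff.support := Finsupp.mem_support_iff.2 h
  obtain ⟨u, hu, v, hv, huv⟩ := Finset.mem_mul.1 (MonoidAlgebra.support_coeff_mul_subset f g hmem)
  apply hl
  rw [← show u.toList ++ v.toList = l from huv, List.count_append]
  congr 1
  · by_contra hne
    exact Finsupp.mem_support_iff.1 hu (hf u.toList hne)
  · by_contra hne
    exact Finsupp.mem_support_iff.1 hv (hg v.toList hne)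

theorem lie_mem_countSub [DecidableEq α] {b : α} {c d : ℕ} {f g : NCPoly α}
    (hf : f ∈ countSub b c) (hg : g ∈ countSub b d) : ⁅f, g⁆ ∈ countSub b (c + d) := by
  rw [Ring.lie_def]
  exact sub_mem (mul_mem_countSub hf hg) (add_comm d c ▸ mul_mem_countSub hg hf)

theorem letter_mem_countSub [DecidableEq α] (a b : α) :
    letter a ∈ countSub b (if a = b then 1 else 0) := by
  intro l hl
  rw [cf_letter, if_neg]
  rintro rfl
  simp [List.count_singleton] at hl

/-! ## Words with few letters `b` -/

/-- The word `a^i b a^j`. -/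
def word₂ (a b : α) (i j : ℕ) : List α := List.replicate i a ++ b :: List.replicate j a

/-- The word `a^i b a^j b a^l`. -/
def word₃ (a b : α) (i j l : ℕ) : List α := List.replicate i a ++ b :: word₂ a b j l

theorem word₂_zero (a b : α) (j : ℕ) : word₂ a b 0 j = b :: List.replicate j a := rfl

theorem word₂_succ (a b : α) (i j : ℕ) : word₂ a b (i + 1) j = a :: word₂ a b i j := rfl

theorem word₂_zero_right (a b : α) (i : ℕ) : word₂ a b i 0 = List.replicate i a ++ [b] := rfl

theorem word₂_succ_right (a b : α) (i j : ℕ) : word₂ a b i (j + 1) = word₂ a b i j ++ [a] := by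
  simp [word₂, List.replicate_succ']

theorem word₃_zero (a b : α) (j l : ℕ) : word₃ a b 0 j l = b :: word₂ a b j l := rfl

theorem word₃_succ (a b : α) (i j l : ℕ) : word₃ a b (i + 1) j l = a :: word₃ a b i j l := rfl

theorem word₃_zero_right (a b : α) (i j : ℕ) : word₃ a b i j 0 = word₂ a b i j ++ [b] := by
  simp [word₃, word₂]

theorem word₃_succ_right (a b : α) (i j l : ℕ) :
    word₃ a b i j (l + 1) = word₃ a b i j l ++ [a] := by
  simp [word₃, word₂_succ_right]

theorem reverse_word₂ (a b : α) (i j : ℕ) : (word₂ a b i j).reverse = word₂ a b j i := by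
  simp [word₂]

theorem reverse_word₃ (a b : α) (i j l : ℕ) : (word₃ a b i j l).reverse = word₃ a b l j i := by
  simp [word₃, word₂]

theorem length_word₂ (a b : α) (i j : ℕ) : (word₂ a b i j).length = i + j + 1 := by
  simp [word₂]; ring

theorem length_word₃ (a b : α) (i j l : ℕ) : (word₃ a b i j l).length = i + j + l + 2 := by
  simp [word₃, word₂]; ring

theorem cf_lie_eq_zero_of_notMem [DecidableEq α] {c : α} {l : List α} (hc : c ∉ l)
    (f : NCPoly α) : cf l ⁅letter c, f⁆ = 0 := by
  rw [Ring.lie_def, map_sub]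
  have left : cf l (letter c * f) = 0 := by
    cases l with
    | nil => simp
    | cons d l => rw [cf_cons_letter_mul, if_neg (by rintro rfl; simp at hc)]
  have right : cf l (f * letter c) = 0 := by
    induction l using List.reverseRecOn with
    | nil => simp
    | append_singleton l d => rw [cf_concat_mul_letter, if_neg (by rintro rfl; simp at hc)]
  rw [left, right, sub_zero]

section LetterBracket

variable [DecidableEq α] {a b : α} (hab : a ≠ b) (f : NCPoly α)

include hab

theorem cf_replicate_lie_right (i : ℕ) : cf (List.replicate i a) ⁅letter b, f⁆ = 0 := by
  rw [Ring.lie_def, map_sub]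
  cases i with
  | zero => simp
  | succ i =>
    rw [List.replicate_succ, cf_cons_letter_mul, if_neg hab, ← List.replicate_succ,
      List.replicate_succ', cf_concat_mul_letter, if_neg hab, sub_zero]

omit hab in
theorem cf_replicate_lie_left (i : ℕ) : cf (List.replicate i a) ⁅letter a, f⁆ = 0 := by
  rw [Ring.lie_def, map_sub]
  cases i with
  | zero => simp
  | succ i =>
    rw [List.replicate_succ, cf_cons_letter_mul, if_pos rfl, ← List.replicate_succ,
      List.replicate_succ', cf_concat_mul_letter, if_pos rfl, sub_self]

theorem cf_word₂_lie_left (i j : ℕ) : cf (word₂ a b i j) ⁅letter a, f⁆ =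
    (if i = 0 then 0 else cf (word₂ a b (i - 1) j) f) -
      (if j = 0 then 0 else cf (word₂ a b i (j - 1)) f) := by
  rw [Ring.lie_def, map_sub]
  congr 1
  · cases i <;> simp [word₂_zero, word₂_succ, hab.symm]
  · cases j <;> simp [word₂_zero_right, word₂_succ_right, hab.symm]

theorem cf_word₂_lie_right (i j : ℕ) : cf (word₂ a b i j) ⁅letter b, f⁆ =
    (if i = 0 then cf (List.replicate j a) f else 0) -
      (if j = 0 then cf (List.replicate i a) f else 0) := by
  rw [Ring.lie_def, map_sub]
  congr 1
  · cases i <;> simp [word₂_zero, word₂_succ, hab]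
  · cases j <;> simp [word₂_zero_right, word₂_succ_right, hab]

theorem cf_word₃_lie_left (i j l : ℕ) : cf (word₃ a b i j l) ⁅letter a, f⁆ =
    (if i = 0 then 0 else cf (word₃ a b (i - 1) j l) f) -
      (if l = 0 then 0 else cf (word₃ a b i j (l - 1)) f) := by
  rw [Ring.lie_def, map_sub]
  congr 1
  · cases i <;> simp [word₃_zero, word₃_succ, hab.symm]
  · cases l <;> simp [word₃_zero_right, word₃_succ_right, hab.symm]

theorem cf_word₃_lie_right (i j l : ℕ) : cf (word₃ a b i j l) ⁅letter b, f⁆ =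
    (if i = 0 then cf (word₂ a b j l) f else 0) -
      (if l = 0 then cf (word₂ a b i j) f else 0) := by
  rw [Ring.lie_def, map_sub]
  congr 1
  · cases i <;> simp [word₃_zero, word₃_succ, hab]
  · cases l <;> simp [word₃_zero_right, word₃_succ_right, hab]

end LetterBracket

/-! ## Linear relations between the coefficients of a Lie element -/

theorem cf_reverse [DecidableEq α] {n : ℕ} {f : NCPoly α} (hf : f ∈ lieDeg α n) (l : List α) :
    cf l.reverse f = (-1) ^ n * cf l f := by
  refine lieDeg_induction (P := fun n f => ∀ l, cf l.reverse f = (-1) ^ n * cf l f)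
    ?_ ?_ ?_ ?_ ?_ hf l
  · simp
  · intro n f g hf hg l
    rw [map_add, map_add, hf, hg, mul_add]
  · intro n c f hf l
    rw [map_smul, map_smul, hf, smul_eq_mul, smul_eq_mul, mul_left_comm]
  · intro a l
    simp [cf_letter]
  · intro n a ξ _ ih l
    have key : ∀ l, cf l.reverse (letter a * ξ) = (-1) ^ n * cf l (ξ * letter a) := by
      intro l
      induction l using List.reverseRecOn with
      | nil => simp
      | append_singleton l c => simp [ih]
    have key' : ∀ l, cf l.reverse (ξ * letter a) = (-1) ^ n * cf l (letter a * ξ) := by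
      intro l
      cases l with
      | nil => simp
      | cons c l => simp [ih]
    rw [Ring.lie_def, map_sub, map_sub, key, key', pow_succ]
    ring

section BlockRelations

variable [DecidableEq α] {a b : α} (hab : a ≠ b)

include hab

/-- Invariance of Lie elements under the translation `a ↦ a + 1`, up to constant terms, read off in
words with at most two letters `b`. -/
theorem lieDeg_block_relations {n : ℕ} {f : NCPoly α} (hf : f ∈ lieDeg α n) :
    (∀ i, cf (List.replicate (i + 2) a) f = 0) ∧
    (∀ i j : ℕ, (i + 1) * cf (word₂ a b (i + 1) j) f + (j + 1) * cf (word₂ a b i (j + 1)) f = 0) ∧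
    (∀ i j l : ℕ, (i + 1) * cf (word₃ a b (i + 1) j l) f + (j + 1) * cf (word₃ a b i (j + 1) l) f
      + (l + 1) * cf (word₃ a b i j (l + 1)) f = 0) := by
  refine lieDeg_induction (P := fun _ f =>
    (∀ i, cf (List.replicate (i + 2) a) f = 0) ∧
    (∀ i j : ℕ, (i + 1) * cf (word₂ a b (i + 1) j) f + (j + 1) * cf (word₂ a b i (j + 1)) f = 0) ∧
    (∀ i j l : ℕ, (i + 1) * cf (word₃ a b (i + 1) j l) f + (j + 1) * cf (word₃ a b i (j + 1) l) f
      + (l + 1) * cf (word₃ a b i j (l + 1)) f = 0)) ?_ ?_ ?_ ?_ ?_ hf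
  · simp
  · rintro _ f g ⟨h₁, h₂, h₃⟩ ⟨k₁, k₂, k₃⟩
    simp only [map_add]
    refine ⟨fun i => by rw [h₁, k₁, add_zero], fun i j => ?_, fun i j l => ?_⟩
    · linear_combination h₂ i j + k₂ i j
    · linear_combination h₃ i j l + k₃ i j l
  · rintro _ c f ⟨h₁, h₂, h₃⟩
    simp only [map_smul, smul_eq_mul]
    refine ⟨fun i => by rw [h₁, mul_zero], fun i j => ?_, fun i j l => ?_⟩
    · linear_combination c * h₂ i j
    · linear_combination c * h₃ i j l
  · intro c
    have ne : ∀ l : List α, l.length ≠ 1 → cf l (letter c) = 0 := by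
      intro l hl
      rw [cf_letter, if_neg]
      rintro rfl
      exact hl rfl
    refine ⟨fun i => ne _ (by simp), fun i j => ?_, fun i j l => ?_⟩
    · rw [ne _ (by rw [length_word₂]; omega), ne _ (by rw [length_word₂]; omega)]
      ring
    · rw [ne _ (by rw [length_word₃]; omega), ne _ (by rw [length_word₃]; omega),
        ne _ (by rw [length_word₃]; omega)]
      ring
  · rintro _ c f - ⟨h₁, h₂, h₃⟩
    by_cases hca : c = a
    · subst hca
      refine ⟨fun i => cf_replicate_lie_left f _, fun i j => ?_, fun i j l => ?_⟩
      · have e₁ := h₂ (i - 1) j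
        have e₂ := h₂ i (j - 1)
        simp only [cf_word₂_lie_left hab]
        rcases i with _ | i <;> rcases j with _ | j <;> simp at e₁ e₂ ⊢ <;>
          first | linear_combination e₁ - e₂ | linear_combination e₁ | linear_combination -e₂
      · have e₁ := h₃ (i - 1) j l
        have e₂ := h₃ i j (l - 1)
        simp only [cf_word₃_lie_left hab]
        rcases i with _ | i <;> rcases l with _ | l <;> simp at e₁ e₂ ⊢ <;>
          first | linear_combination e₁ - e₂ | linear_combination e₁ | linear_combination -e₂
    by_cases hcb : c = b
    · subst hcb
      refine ⟨fun i => cf_replicate_lie_right hab f _, fun i j => ?_, fun i j l => ?_⟩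
      · simp only [cf_word₂_lie_right hab]
        rcases i with _ | i <;> rcases j with _ | j <;> simp [h₁]
      · have e₁ := h₂ j l
        have e₂ := h₂ i j
        simp only [cf_word₃_lie_right hab]
        rcases i with _ | i <;> rcases l with _ | l <;> simp at e₁ e₂ ⊢ <;>
          first | linear_combination e₁ - e₂ | linear_combination e₁ | linear_combination -e₂
    have ne₂ : ∀ i j, cf (word₂ a b i j) ⁅letter c, f⁆ = 0 := fun i j =>
      cf_lie_eq_zero_of_notMem (by simp [word₂, hca, hcb]) f
    have ne₃ : ∀ i j l, cf (word₃ a b i j l) ⁅letter c, f⁆ = 0 := fun i j l =>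
      cf_lie_eq_zero_of_notMem (by simp [word₃, word₂, hca, hcb]) f
    refine ⟨fun i => cf_lie_eq_zero_of_notMem (by simp [hca]) f, fun i j => ?_, fun i j l => ?_⟩
    · simp [ne₂]
    · simp [ne₃]

end BlockRelations

/-! ## Cyclically symmetric functions on words whose slices are Lie elements -/

/-- A function on words whose slices along the first letter are Lie elements of degree `k + 1`, and
that is invariant under moving the first letter of a word of length `k + 2` to its end. -/
structure IsCyclicLie (k : ℕ) (φ : List α → ℚ) : Prop where
  slice : ∀ c, ∃ f ∈ lieDeg α k, ∀ l, φ (c :: l) = cf l f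
  rotate_one : ∀ c l, l.length = k + 1 → φ (c :: l) = φ (l ++ [c])

theorem eq_replicate_of_count_eq_zero [DecidableEq α] {a b : α} (hall : ∀ c, c = a ∨ c = b)
    {l : List α} (h : l.count b = 0) : l = List.replicate l.length a :=
  List.eq_replicate_of_mem fun c hc =>
    (hall c).resolve_right fun hcb => List.count_eq_zero.1 h (hcb ▸ hc)

theorem exists_append_cons_of_count_succ [DecidableEq α] {a b : α} (hall : ∀ c, c = a ∨ c = b)
    {l : List α} {c : ℕ} (h : l.count b = c + 1) :
    ∃ i l', l = List.replicate i a ++ b :: l' ∧ l'.count b = c := by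
  obtain ⟨u, v, rfl, hu⟩ := List.eq_append_cons_of_mem (List.count_pos_iff.1 (by omega : 0 < l.count b))
  have hu' : u.count b = 0 := List.count_eq_zero.2 hu
  refine ⟨u.length, v, ?_, ?_⟩
  · rw [← eq_replicate_of_count_eq_zero hall hu']
  · simpa [hu'] using h

theorem exists_word₂_of_count_eq_one [DecidableEq α] {a b : α} (hall : ∀ c, c = a ∨ c = b)
    {l : List α} (h : l.count b = 1) : ∃ i j, l = word₂ a b i j := by
  obtain ⟨i, l', rfl, hl'⟩ := exists_append_cons_of_count_succ hall h
  exact ⟨i, l'.length, by rw [word₂, ← eq_replicate_of_count_eq_zero hall hl']⟩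

theorem exists_word₃_of_count_eq_two [DecidableEq α] {a b : α} (hall : ∀ c, c = a ∨ c = b)
    {l : List α} (h : l.count b = 2) : ∃ i j p, l = word₃ a b i j p := by
  obtain ⟨i, l', rfl, hl'⟩ := exists_append_cons_of_count_succ hall h
  obtain ⟨j, p, rfl⟩ := exists_word₂_of_count_eq_one hall hl'
  exact ⟨i, j, p, rfl⟩

namespace IsCyclicLie

variable {k : ℕ} {φ : List α → ℚ} (hφ : IsCyclicLie k φ)

include hφ

theorem rotate (l l' : List α) (h : l.length + l'.length = k + 2) : φ (l ++ l') = φ (l' ++ l) := by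
  induction l generalizing l' with
  | nil => simp
  | cons c l ih =>
    simp only [List.length_cons] at h
    rw [List.cons_append, hφ.rotate_one c _ (by rw [List.length_append]; omega), List.append_assoc,
      ih (l' ++ [c]) (by simp; omega), List.append_assoc, List.singleton_append]

variable [DecidableEq α]

theorem reverse (c : α) (l : List α) : φ (c :: l.reverse) = (-1) ^ k * φ (c :: l) := by
  obtain ⟨f, hf, h⟩ := hφ.slice c
  rw [h, h, cf_reverse hf]

variable {a b : α} (hab : a ≠ b)

theorem exists_eq_cons_of_count_succ (hall : ∀ c, c = a ∨ c = b) {l : List α}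
    {c : ℕ} (hl : l.length = k + 2) (h : l.count b = c + 1) :
    ∃ l', l'.length = k + 1 ∧ l'.count b = c ∧ φ l = φ (b :: l') := by
  obtain ⟨i, l', rfl, hl'⟩ := exists_append_cons_of_count_succ hall h
  simp only [List.length_append, List.length_replicate, List.length_cons] at hl
  refine ⟨l' ++ List.replicate i a, by simp; omega, ?_, ?_⟩
  · simpa [List.count_append, hl'] using h
  · rw [hφ.rotate _ _ (by simp; omega), List.cons_append]

include hab

theorem block_two (c : α) (i j : ℕ) :
    (i + 1) * φ (c :: word₂ a b (i + 1) j) + (j + 1) * φ (c :: word₂ a b i (j + 1)) = 0 := by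
  obtain ⟨f, hf, h⟩ := hφ.slice c
  rw [h, h]
  exact (lieDeg_block_relations hab hf).2.1 i j

theorem block_three (c : α) (i j l : ℕ) : (i + 1) * φ (c :: word₃ a b (i + 1) j l) +
    (j + 1) * φ (c :: word₃ a b i (j + 1) l) + (l + 1) * φ (c :: word₃ a b i j (l + 1)) = 0 := by
  obtain ⟨f, hf, h⟩ := hφ.slice c
  rw [h, h, h]
  exact (lieDeg_block_relations hab hf).2.2 i j l

theorem eq_zero_of_count_le_one (hk : 1 ≤ k) (hall : ∀ c, c = a ∨ c = b) {l : List α}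
    (hl : l.length = k + 2) (h : l.count b ≤ 1) : φ l = 0 := by
  have key : ∀ c, φ (c :: List.replicate (k + 1) a) = 0 := by
    intro c
    obtain ⟨f, hf, h⟩ := hφ.slice c
    obtain ⟨i, rfl⟩ := Nat.exists_eq_add_of_le' hk
    rw [h]
    exact (lieDeg_block_relations hab hf).1 i
  interval_cases hc : l.count b
  · rw [eq_replicate_of_count_eq_zero hall hc, hl, List.replicate_succ]
    exact key a
  · obtain ⟨l', hl', hc', h'⟩ := hφ.exists_eq_cons_of_count_succ hall hl hc
    rw [h', eq_replicate_of_count_eq_zero hall hc', hl']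
    exact key b

omit hab in
theorem eq_zero_of_count_eq_two_of_odd (hk : Odd k) (hall : ∀ c, c = a ∨ c = b) {l : List α}
    (hl : l.length = k + 2) (h : l.count b = 2) : φ l = 0 := by
  obtain ⟨l', hl', hc', h'⟩ := hφ.exists_eq_cons_of_count_succ hall hl h
  obtain ⟨i, j, rfl⟩ := exists_word₂_of_count_eq_one hall hc'
  rw [length_word₂] at hl'
  have hrev := hφ.reverse b (word₂ a b i j)
  have hrot := hφ.rotate (b :: List.replicate i a) (b :: List.replicate j a) (by simp; omega)
  change φ (b :: word₂ a b i j) = φ (b :: word₂ a b j i) at hrot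
  rw [reverse_word₂, hk.neg_one_pow, ← hrot] at hrev
  rw [h']
  linarith

theorem eq_zero_of_count_eq_two_of_top (hall : ∀ c, c = a ∨ c = b)
    (htop : φ (b :: word₂ a b 0 k) = 0) {l : List α} (hl : l.length = k + 2) (h : l.count b = 2) :
    φ l = 0 := by
  obtain ⟨l', hl', hc', h'⟩ := hφ.exists_eq_cons_of_count_succ hall hl h
  obtain ⟨i, j, rfl⟩ := exists_word₂_of_count_eq_one hall hc'
  rw [length_word₂] at hl'
  rw [h']
  clear h' hc'
  induction i generalizing j with
  | zero =>
    obtain rfl : j = k := by omega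
    exact htop
  | succ i ih =>
    have hrel := hφ.block_two hab b i j
    rw [ih (j + 1) (by omega), mul_zero, add_zero] at hrel
    exact (mul_eq_zero.1 hrel).resolve_left (by positivity)

theorem eq_zero_of_count_eq_three (hk : Odd k) (hall : ∀ c, c = a ∨ c = b)
    (htop : ∀ i < k / 6, ∀ j, 2 * i + 1 + j + 1 = k → φ (b :: word₃ a b (2 * i + 1) 0 j) = 0)
    {l : List α} (hl : l.length = k + 2) (h : l.count b = 3) : φ l = 0 := by
  obtain ⟨l', hl', hc', h'⟩ := hφ.exists_eq_cons_of_count_succ hall hl h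
  obtain ⟨p, q, r, rfl⟩ := exists_word₃_of_count_eq_two hall hc'
  rw [length_word₃] at hl'
  obtain ⟨d, rfl⟩ : ∃ d, k = d + 1 := ⟨k - 1, by omega⟩
  have hd : Even d := by
    rcases hk with ⟨e, he⟩
    exact ⟨e, by omega⟩
  rw [h']
  refine array_eq_zero (g := fun i j l => φ (b :: word₃ a b i j l)) (d := d) (N := (d + 1) / 6) hd
    (hφ.block_three hab b) ?_ ?_ ?_ (by omega) (by omega)
  · intro i j l _
    rw [← reverse_word₃, hφ.reverse, hk.neg_one_pow, neg_one_mul]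
  · intro i j hij
    simpa [word₃, word₂] using (hφ.rotate (b :: List.replicate i a) (b :: b :: List.replicate j a)
      (by simp; omega)).symm
  · intro i hi j hij
    exact htop i hi j (by omega)

/-- In low odd degree there is no room for four letters of each kind. -/
theorem eq_zero_of_odd_of_lt (hk : Odd k) (hk' : k < 6) (hall : ∀ c, c = a ∨ c = b) {l : List α}
    (hl : l.length = k + 2) : φ l = 0 := by
  have key : ∀ {a b : α}, a ≠ b → (∀ c, c = a ∨ c = b) → l.count b ≤ 3 → φ l = 0 := by
    intro a b hab hall h
    interval_cases hc : l.count b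
    · exact hφ.eq_zero_of_count_le_one hab hk.pos hall hl (by omega)
    · exact hφ.eq_zero_of_count_le_one hab hk.pos hall hl (by omega)
    · exact hφ.eq_zero_of_count_eq_two_of_odd hk hall hl hc
    · exact hφ.eq_zero_of_count_eq_three hab hk hall (fun i hi => by omega) hl hc
  have hcount : l.count a + l.count b = l.length := by
    clear hl key
    induction l with
    | nil => rfl
    | cons c l ih =>
      rcases hall c with rfl | rfl
      · rw [List.count_cons_self, List.count_cons_of_ne hab, List.length_cons]; omega
      · rw [List.count_cons_self, List.count_cons_of_ne hab.symm, List.length_cons]; omega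
  by_cases h : l.count b ≤ 3
  · exact key hab hall h
  · exact key hab.symm (fun c => (hall c).symm) (by omega)

end IsCyclicLie

/-! ## Construction of cyclically symmetric Lie elements -/

/-- Iterated bracket with the letter `a`. -/
def adPow (a : α) : ℕ → NCPoly α → NCPoly α
  | 0, f => f
  | n + 1, f => ⁅letter a, adPow a n f⁆

theorem adPow_lie_letter (a : α) (n : ℕ) (f : NCPoly α) :
    adPow a n ⁅letter a, f⁆ = adPow a (n + 1) f := by
  induction n with
  | zero => rfl
  | succ n ih =>
    rw [adPow, ih]
    rfl

theorem adPow_adPow (a : α) (m n : ℕ) (f : NCPoly α) :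
    adPow a m (adPow a n f) = adPow a (m + n) f := by
  induction m with
  | zero => rw [Nat.zero_add]; rfl
  | succ m ih => rw [adPow, ih, Nat.add_right_comm, adPow]

theorem adPow_mem_lieDeg (a : α) {m : ℕ} {f : NCPoly α} (hf : f ∈ lieDeg α m) (n : ℕ) :
    adPow a n f ∈ lieDeg α (m + n) := by
  induction n with
  | zero => exact hf
  | succ n ih => exact letter_lie_mem_lieDeg a ih

section Construction

variable [DecidableEq α] {a b : α} (hab : a ≠ b)

include hab

theorem adPow_mem_countSub {c : ℕ} {f : NCPoly α} (hf : f ∈ countSub b c) (n : ℕ) :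
    adPow a n f ∈ countSub b c := by
  induction n with
  | zero => exact hf
  | succ n ih =>
    have h := lie_mem_countSub (letter_mem_countSub a b) ih
    rwa [if_neg hab, Nat.zero_add] at h

theorem adPow_letter_mem_countSub (n : ℕ) : adPow a n (letter b) ∈ countSub b 1 :=
  adPow_mem_countSub hab (by simpa using letter_mem_countSub b b) n

theorem exists_lie_letter_eq {m c : ℕ} {Z : NCPoly α} (hZ : Z ∈ lieDeg α m)
    (hZc : Z ∈ countSub b c) (n : ℕ) : ∃ F ∈ lieDeg α (m + n), F ∈ countSub b (1 + c) ∧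
      ⁅letter a, F⁆ = ⁅letter b, adPow a n Z⁆ - (-1 : ℚ) ^ n • ⁅adPow a n (letter b), Z⁆ := by
  induction n generalizing m Z with
  | zero => exact ⟨0, zero_mem _, zero_mem _, by simp [adPow]⟩
  | succ n ih =>
    have hZc' : ⁅letter a, Z⁆ ∈ countSub b c := adPow_mem_countSub hab hZc 1
    obtain ⟨F, hF, hFc, h⟩ := ih (letter_lie_mem_lieDeg a hZ) hZc'
    have hY : adPow a n (letter b) ∈ lieDeg α n := by
      simpa using adPow_mem_lieDeg a (letter_mem_lieDeg b) n
    refine ⟨F + (-1 : ℚ) ^ n • ⁅adPow a n (letter b), Z⁆, add_mem ?_ (Submodule.smul_mem _ _ ?_),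
      add_mem hFc (Submodule.smul_mem _ _
        (lie_mem_countSub (adPow_letter_mem_countSub hab n) hZc)), ?_⟩
    · rwa [show m + (n + 1) = m + 1 + n by ring]
    · rw [show m + (n + 1) = n + m + 1 by ring]
      exact lie_mem_lieDeg hY hZ
    · rw [lie_add, h, adPow_lie_letter, lie_smul, leibniz_lie (letter a) (adPow a n (letter b)) Z,
        adPow, pow_succ, smul_add]
      simp only [mul_neg, mul_one, neg_smul]
      abel

/-- The tripod with legs `p`, `q`, `r`. -/
def tripod (a b : α) (p q r : ℕ) : NCPoly α :=
  (-1 : ℚ) ^ p • adPow a p ⁅adPow a q (letter b), adPow a r (letter b)⁆ +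
  (-1 : ℚ) ^ q • adPow a q ⁅adPow a r (letter b), adPow a p (letter b)⁆ +
  (-1 : ℚ) ^ r • adPow a r ⁅adPow a p (letter b), adPow a q (letter b)⁆

omit hab [DecidableEq α] in
theorem adPow_lie_adPow_mem_lieDeg (a b : α) (p q r : ℕ) :
    adPow a p ⁅adPow a q (letter b), adPow a r (letter b)⁆ ∈ lieDeg α (q + r + 1 + p) := by
  have hY : ∀ n, adPow a n (letter b) ∈ lieDeg α n := fun n => by
    simpa using adPow_mem_lieDeg a (letter_mem_lieDeg b) n
  exact adPow_mem_lieDeg a (lie_mem_lieDeg (hY q) (hY r)) p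

omit hab [DecidableEq α] in
theorem tripod_mem_lieDeg (a b : α) (p q r : ℕ) : tripod a b p q r ∈ lieDeg α (p + q + r + 1) := by
  refine add_mem (add_mem ?_ ?_) ?_ <;> refine Submodule.smul_mem _ _ ?_
  · have h := adPow_lie_adPow_mem_lieDeg a b p q r
    rwa [show q + r + 1 + p = p + q + r + 1 by ring] at h
  · have h := adPow_lie_adPow_mem_lieDeg a b q r p
    rwa [show r + p + 1 + q = p + q + r + 1 by ring] at h
  · have h := adPow_lie_adPow_mem_lieDeg a b r p q
    rwa [show p + q + 1 + r = p + q + r + 1 by ring] at h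

theorem tripod_mem_countSub (p q r : ℕ) : tripod a b p q r ∈ countSub b 2 := by
  have h : ∀ p q r, adPow a p ⁅adPow a q (letter b), adPow a r (letter b)⁆ ∈ countSub b 2 :=
    fun p q r => adPow_mem_countSub hab (lie_mem_countSub (adPow_letter_mem_countSub hab q)
      (adPow_letter_mem_countSub hab r)) p
  exact add_mem (add_mem (Submodule.smul_mem _ _ (h _ _ _)) (Submodule.smul_mem _ _ (h _ _ _)))
    (Submodule.smul_mem _ _ (h _ _ _))

theorem exists_lie_add_lie_tripod_eq_zero (p q r : ℕ) :
    ∃ F ∈ lieDeg α (p + q + r + 1), F ∈ countSub b 3 ∧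
      ⁅letter a, F⁆ + ⁅letter b, tripod a b p q r⁆ = 0 := by
  have hY : ∀ n, adPow a n (letter b) ∈ lieDeg α n := fun n => by
    simpa using adPow_mem_lieDeg a (letter_mem_lieDeg b) n
  have key : ∀ p q r, ∃ F ∈ lieDeg α (q + r + 1 + p), F ∈ countSub b 3 ∧ ⁅letter a, F⁆ =
      ⁅letter b, adPow a p ⁅adPow a q (letter b), adPow a r (letter b)⁆⁆ - (-1 : ℚ) ^ p •
        ⁅adPow a p (letter b), ⁅adPow a q (letter b), adPow a r (letter b)⁆⁆ := fun p q r =>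
    exists_lie_letter_eq hab (lie_mem_lieDeg (hY q) (hY r)) (lie_mem_countSub
      (adPow_letter_mem_countSub hab q) (adPow_letter_mem_countSub hab r)) p
  obtain ⟨F₁, h₁, c₁, e₁⟩ := key p q r
  obtain ⟨F₂, h₂, c₂, e₂⟩ := key q r p
  obtain ⟨F₃, h₃, c₃, e₃⟩ := key r p q
  rw [show q + r + 1 + p = p + q + r + 1 by ring] at h₁
  rw [show r + p + 1 + q = p + q + r + 1 by ring] at h₂
  rw [show p + q + 1 + r = p + q + r + 1 by ring] at h₃
  refine ⟨-((-1 : ℚ) ^ p • F₁ + (-1 : ℚ) ^ q • F₂ + (-1 : ℚ) ^ r • F₃),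
    neg_mem (add_mem (add_mem ?_ ?_) ?_), neg_mem (add_mem (add_mem ?_ ?_) ?_), ?_⟩
  · exact Submodule.smul_mem _ _ h₁
  · exact Submodule.smul_mem _ _ h₂
  · exact Submodule.smul_mem _ _ h₃
  · exact Submodule.smul_mem _ _ c₁
  · exact Submodule.smul_mem _ _ c₂
  · exact Submodule.smul_mem _ _ c₃
  · have hsq : ∀ n : ℕ, (-1 : ℚ) ^ n * (-1) ^ n = 1 := fun n => by rw [← mul_pow]; simp
    have hjac := lie_jacobi (adPow a p (letter b)) (adPow a q (letter b)) (adPow a r (letter b))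
    rw [lie_neg, lie_add, lie_add, lie_smul, lie_smul, lie_smul, e₁, e₂, e₃, tripod, lie_add,
      lie_add, lie_smul, lie_smul, lie_smul]
    simp only [smul_sub, smul_smul, hsq, one_smul]
    rw [← hjac]
    abel

theorem exists_lie_add_lie_adPow_eq_zero (n : ℕ) :
    ∃ F ∈ lieDeg α (n + n), F ∈ countSub b 2 ∧
      ⁅letter a, F⁆ + ⁅letter b, adPow a (n + n) (letter b)⁆ = 0 := by
  have hY : adPow a n (letter b) ∈ lieDeg α n := by
    simpa using adPow_mem_lieDeg a (letter_mem_lieDeg b) n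
  obtain ⟨F, hF, hFc, h⟩ := exists_lie_letter_eq hab hY (adPow_letter_mem_countSub hab n) n
  refine ⟨-F, neg_mem hF, neg_mem hFc, ?_⟩
  rw [lie_neg, h, lie_self, smul_zero, sub_zero, adPow_adPow, neg_add_cancel]

theorem cf_cons_replicate_adPow_letter (n j : ℕ) :
    cf (b :: List.replicate j a) (adPow a n (letter b)) = if j = n then (-1) ^ n else 0 := by
  induction n generalizing j with
  | zero => cases j <;> simp [adPow, cf_letter]
  | succ n ih =>
    rw [← word₂_zero, adPow, cf_word₂_lie_left hab]
    cases j with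
    | zero => simp
    | succ j =>
      simp only [word₂_zero, Nat.add_sub_cancel, ih, if_true, Nat.succ_ne_zero, if_false,
        Nat.add_right_cancel_iff, pow_succ]
      split_ifs <;> simp

theorem cf_adPow_letter_mul (n i : ℕ) (l : List α) (f : NCPoly α) :
    cf (List.replicate i a ++ b :: b :: l) (adPow a n (letter b) * f) =
      if i = n then cf (b :: l) f else 0 := by
  induction n generalizing i f with
  | zero => cases i <;> simp [adPow, List.replicate_succ, hab]
  | succ n ih =>
    rw [adPow, Ring.lie_def, sub_mul, mul_assoc, mul_assoc, map_sub, ih, cf_cons_letter_mul,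
      if_neg hab.symm, ite_self, sub_zero]
    cases i with
    | zero => simp [hab.symm]
    | succ i => simp [List.replicate_succ, ih]

theorem cf_word₃_lie_adPow (q r i j : ℕ) :
    cf (word₃ a b i 0 j) ⁅adPow a q (letter b), adPow a r (letter b)⁆ =
      (if i = q ∧ j = r then (-1) ^ r else 0) - (if i = r ∧ j = q then (-1) ^ q else 0) := by
  rw [Ring.lie_def, map_sub, word₃, word₂_zero, cf_adPow_letter_mul hab, cf_adPow_letter_mul hab,
    cf_cons_replicate_adPow_letter hab, cf_cons_replicate_adPow_letter hab, ite_and, ite_and]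

theorem cf_word₃_adPow {p : ℕ} {f : NCPoly α} (hf : ∀ i < p, ∀ l, cf (word₃ a b i 0 l) f = 0)
    (n : ℕ) : (∀ i < p, ∀ l, cf (word₃ a b i 0 l) (adPow a n f) = 0) ∧
      ∀ l, cf (word₃ a b p 0 (l + n)) (adPow a n f) = (-1) ^ n * cf (word₃ a b p 0 l) f := by
  induction n with
  | zero => exact ⟨hf, by simp [adPow]⟩
  | succ n ih =>
    refine ⟨fun i hi l => ?_, fun l => ?_⟩
    · rw [adPow, cf_word₃_lie_left hab, ih.1 _ (by omega), ih.1 _ hi, ite_self, ite_self, sub_zero]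
    · rw [adPow, cf_word₃_lie_left hab, if_neg (by omega : l + (n + 1) ≠ 0),
        show l + (n + 1) - 1 = l + n by omega, ih.2, pow_succ]
      split_ifs with hp
      · ring
      · rw [ih.1 _ (by omega)]
        ring

theorem cf_word₃_tripod_eq_zero {p q r i : ℕ} (hpq : p < q) (hpr : p < r) (hi : i < p) (l : ℕ) :
    cf (word₃ a b i 0 l) (tripod a b p q r) = 0 := by
  have key : ∀ p' q' r', i < q' → i < r' →
      cf (word₃ a b i 0 l) (adPow a p' ⁅adPow a q' (letter b), adPow a r' (letter b)⁆) = 0 := by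
    intro p' q' r' hq hr
    refine (cf_word₃_adPow hab (p := i + 1) (fun j hj l => ?_) p').1 i (by omega) l
    rw [cf_word₃_lie_adPow hab, if_neg (by omega), if_neg (by omega), sub_zero]
  rw [tripod, map_add, map_add, map_smul, map_smul, map_smul, key _ _ _ (by omega) (by omega),
    key _ _ _ (by omega) (by omega), key _ _ _ (by omega) (by omega)]
  simp

theorem cf_word₃_tripod {p q r : ℕ} (hpq : p < q) (hpr : p < r) :
    cf (word₃ a b p 0 (q + r)) (tripod a b p q r) = (-1) ^ q - (-1) ^ r := by
  have h₁ : cf (word₃ a b p 0 (q + r))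
      (adPow a p ⁅adPow a q (letter b), adPow a r (letter b)⁆) = 0 := by
    refine (cf_word₃_adPow hab (p := p + 1) (fun j hj l => ?_) p).1 p (by omega) _
    rw [cf_word₃_lie_adPow hab, if_neg (by omega), if_neg (by omega), sub_zero]
  have h₂ : cf (word₃ a b p 0 (q + r))
      (adPow a q ⁅adPow a r (letter b), adPow a p (letter b)⁆) = (-1) ^ q * -(-1) ^ r := by
    rw [add_comm q r, (cf_word₃_adPow hab (p := p) (fun j hj l => ?_) q).2,
      cf_word₃_lie_adPow hab, if_neg (by omega), if_pos ⟨rfl, rfl⟩, zero_sub]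
    rw [cf_word₃_lie_adPow hab, if_neg (by omega), if_neg (by omega), sub_zero]
  have h₃ : cf (word₃ a b p 0 (q + r))
      (adPow a r ⁅adPow a p (letter b), adPow a q (letter b)⁆) = (-1) ^ r * (-1) ^ q := by
    rw [(cf_word₃_adPow hab (p := p) (fun j hj l => ?_) r).2,
      cf_word₃_lie_adPow hab, if_pos ⟨rfl, rfl⟩, if_neg (by omega), sub_zero]
    rw [cf_word₃_lie_adPow hab, if_neg (by omega), if_neg (by omega), sub_zero]
  have hsq : ∀ n : ℕ, (-1 : ℚ) ^ n * (-1) ^ n = 1 := fun n => by rw [← mul_pow]; simp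
  rw [tripod, map_add, map_add, map_smul, map_smul, map_smul, h₁, h₂, h₃]
  simp only [smul_eq_mul]
  linear_combination (-(-1) ^ r) * hsq q + (-1) ^ q * hsq r

end Construction

end NCPoly

/-! ## Tensors as noncommutative polynomials -/

section Tensors

attribute [local instance] LieRing.ofAssociativeRing

open NCPoly

variable {g : ℕ}

/-- The component of degree `m` of a noncommutative polynomial, as a tensor. -/
def tensorOf (g m : ℕ) : NCPoly (Fin (2 * g)) →ₗ[ℚ] Tens g m where
  toFun f w := cf (List.ofFn w) f
  map_add' f h := funext fun w => map_add (cf (List.ofFn w)) f h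
  map_smul' r f := funext fun w => map_smul (cf (List.ofFn w)) r f

theorem tensorOf_apply {m : ℕ} (f : NCPoly (Fin (2 * g))) (w : Fin m → Fin (2 * g)) :
    tensorOf g m f w = cf (List.ofFn w) f := rfl

theorem tensorOf_letter_mul {m : ℕ} (c : Fin (2 * g)) (f : NCPoly (Fin (2 * g))) :
    tensorOf g (m + 1) (letter c * f) = oneTmul (stdB g c) (tensorOf g m f) := by
  funext w
  rw [tensorOf_apply, List.ofFn_succ, cf_cons_letter_mul, oneTmul, stdB, tensorOf_apply, ite_mul,
    one_mul, zero_mul]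

theorem tensorOf_letter_lie {m : ℕ} (c : Fin (2 * g)) (f : NCPoly (Fin (2 * g))) :
    tensorOf g (m + 1) ⁅letter c, f⁆ = oneBrkt (stdB g c) (tensorOf g m f) := by
  rw [Ring.lie_def, map_sub, tensorOf_letter_mul]
  funext w
  rw [Pi.sub_apply, tensorOf_apply, List.ofFn_succ_last, cf_concat_mul_letter, oneTmul, oneBrkt,
    tensorOf_apply, tensorOf_apply]
  simp only [stdB, mul_ite, mul_one, mul_zero]

theorem oneTmul_eq_sum {m : ℕ} (u : HH g) (ξ : Tens g m) :
    oneTmul u ξ = ∑ c, u c • oneTmul (stdB g c) ξ := by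
  funext w
  simp [Finset.sum_apply, oneTmul, stdB]

theorem oneBrkt_eq_sum {m : ℕ} (u : HH g) (ξ : Tens g m) :
    oneBrkt u ξ = ∑ c, u c • oneBrkt (stdB g c) ξ := by
  funext w
  simp [Finset.sum_apply, oneBrkt, stdB, mul_sub, Finset.sum_sub_distrib, mul_comm]

theorem oneBrkt_mem_Lsub {m : ℕ} (u : HH g) {ξ : Tens g (m + 1)} (hξ : ξ ∈ Lsub g m) :
    oneBrkt u ξ ∈ Lsub g (m + 1) := by
  refine Submodule.span_induction ?_ ?_ ?_ ?_ hξ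
  · rintro _ ⟨v, rfl⟩
    exact Submodule.subset_span ⟨Fin.cons u v, by simp [leftNormed]⟩
  · convert zero_mem (Lsub g (m + 1)) using 1
    funext w
    simp [oneBrkt]
  · intro ξ η _ _ hξ hη
    convert add_mem hξ hη using 1
    funext w
    simp only [oneBrkt, Pi.add_apply]
    ring
  · intro c ξ _ hξ
    convert Submodule.smul_mem _ c hξ using 1
    funext w
    simp only [oneBrkt, Pi.smul_apply, smul_eq_mul]
    ring

theorem tensorOf_mem_Lsub {m : ℕ} {f : NCPoly (Fin (2 * g))} (hf : f ∈ lieDeg (Fin (2 * g)) m) :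
    tensorOf g (m + 1) f ∈ Lsub g m := by
  refine lieDeg_induction (P := fun m f => tensorOf g (m + 1) f ∈ Lsub g m) ?_ ?_ ?_ ?_ ?_ hf
  · intro m
    rw [map_zero]
    exact zero_mem _
  · intro m f h hf hh
    rw [map_add]
    exact add_mem hf hh
  · intro m c f hf
    rw [map_smul]
    exact Submodule.smul_mem _ _ hf
  · intro c
    refine Submodule.subset_span ⟨fun _ => stdB g c, ?_⟩
    funext w
    simp [leftNormed, tensorOf_apply, cf_letter, stdB]
  · intro m c f _ hf
    rw [tensorOf_letter_lie]
    exact oneBrkt_mem_Lsub _ hf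

theorem exists_tensorOf_eq_of_mem_Lsub {m : ℕ} {ξ : Tens g (m + 1)} (hξ : ξ ∈ Lsub g m) :
    ∃ f ∈ lieDeg (Fin (2 * g)) m, tensorOf g (m + 1) f = ξ := by
  change ξ ∈ (lieDeg (Fin (2 * g)) m).map (tensorOf g (m + 1))
  refine Submodule.span_le.2 ?_ hξ
  rintro _ ⟨u, rfl⟩
  induction m with
  | zero =>
    refine ⟨∑ c, u 0 c • letter c,
      sum_mem fun c _ => Submodule.smul_mem _ _ (letter_mem_lieDeg c), ?_⟩
    funext w
    simp [map_sum, leftNormed, tensorOf_apply, cf_letter]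
  | succ m ih =>
    obtain ⟨f, hf, h⟩ := ih (Submodule.subset_span ⟨fun i => u i.succ, rfl⟩) (fun i => u i.succ)
    refine ⟨∑ c, u 0 c • ⁅letter c, f⁆,
      sum_mem fun c _ => Submodule.smul_mem _ _ (letter_lie_mem_lieDeg c hf), ?_⟩
    rw [map_sum, leftNormed, ← h, oneBrkt_eq_sum]
    exact Finset.sum_congr rfl fun c _ => by rw [map_smul, tensorOf_letter_lie]

theorem exists_tensorOf_eq_of_mem_HLsub {k : ℕ} {t : Tens g (k + 2)} (ht : t ∈ HLsub g k) :
    ∃ F : Fin (2 * g) → NCPoly (Fin (2 * g)), (∀ c, F c ∈ lieDeg (Fin (2 * g)) k) ∧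
      tensorOf g (k + 2) (∑ c, letter c * F c) = t := by
  refine Submodule.span_induction ?_ ?_ ?_ ?_ ht
  · rintro _ ⟨u, ξ, hξ, rfl⟩
    obtain ⟨f, hf, rfl⟩ := exists_tensorOf_eq_of_mem_Lsub hξ
    refine ⟨fun c => u c • f, fun c => Submodule.smul_mem _ _ hf, ?_⟩
    rw [map_sum, oneTmul_eq_sum]
    exact Finset.sum_congr rfl fun c _ => by rw [mul_smul_comm, map_smul, tensorOf_letter_mul]
  · exact ⟨0, fun c => zero_mem _, by simp⟩
  · rintro _ _ - - ⟨F, hF, rfl⟩ ⟨G, hG, rfl⟩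
    exact ⟨F + G, fun c => add_mem (hF c) (hG c), by
      simp only [Pi.add_apply, mul_add, Finset.sum_add_distrib, map_add]⟩
  · rintro r _ - ⟨F, hF, rfl⟩
    exact ⟨r • F, fun c => Submodule.smul_mem _ _ (hF c), by
      simp only [Pi.smul_apply, mul_smul_comm, ← Finset.smul_sum, map_smul]⟩

theorem exists_ofFn_eq {α : Type*} {n : ℕ} (l : List α) (h : l.length = n) :
    ∃ w : Fin n → α, List.ofFn w = l := by
  subst h
  exact ⟨l.get, List.ofFn_get l⟩

theorem exists_isCyclicLie_of_mem_hgl {k : ℕ} {t : Tens g (k + 2)} (ht : t ∈ hgl g k) :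
    ∃ φ : List (Fin (2 * g)) → ℚ, IsCyclicLie k φ ∧ ∀ w, t w = φ (List.ofFn w) := by
  obtain ⟨F, hF, rfl⟩ := exists_tensorOf_eq_of_mem_HLsub ht.1
  refine ⟨fun l => cf l (∑ c, letter c * F c), ⟨fun c => ⟨F c, hF c, fun l => ?_⟩, ?_⟩,
    fun w => rfl⟩
  · simp [map_sum]
  · intro c l hl
    obtain ⟨v, rfl⟩ := exists_ofFn_eq l hl
    have h := congrFun (LinearMap.mem_ker.1 ht.2) (Fin.snoc (α := fun _ => Fin (2 * g)) v c)
    have h' := sub_eq_zero.1 h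
    rw [tensorOf_apply, tensorOf_apply, List.ofFn_succ_last] at h'
    simpa [List.ofFn_succ] using h'.symm

theorem betaL_oneTmul {m : ℕ} (u : HH g) (ξ : Tens g m) :
    betaL g m (oneTmul u ξ) = oneBrkt u ξ := by
  funext w
  change oneTmul u ξ w - _ = _
  simp [oneTmul, oneBrkt, mul_comm]

theorem tensorOf_mem_hgl {k : ℕ} {F : Fin (2 * g) → NCPoly (Fin (2 * g))}
    (hF : ∀ c, F c ∈ lieDeg (Fin (2 * g)) k) (h : ∑ c, ⁅letter c, F c⁆ = 0) :
    tensorOf g (k + 2) (∑ c, letter c * F c) ∈ hgl g k := by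
  rw [map_sum]
  simp only [tensorOf_letter_mul]
  refine ⟨sum_mem fun c _ => Submodule.subset_span ⟨_, _, tensorOf_mem_Lsub (hF c), rfl⟩, ?_⟩
  rw [SetLike.mem_coe, LinearMap.mem_ker, map_sum]
  simp only [betaL_oneTmul, ← tensorOf_letter_lie]
  rw [← map_sum, h, map_zero]

theorem wtW_eq {n : ℕ} (w : Fin n → Fin (2 * 1)) :
    wtW w = n - 2 * ((List.ofFn w).count 1 : ℕ) := by
  induction n with
  | zero => simp [wtW]
  | succ n ih =>
    have h := ih fun i => w i.succ
    rw [wtW] at h ⊢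
    rw [Fin.sum_univ_succ, h, List.ofFn_succ, List.count_cons]
    rcases (by decide : ∀ c : Fin (2 * 1), c = 0 ∨ c = 1) (w 0) with h0 | h0 <;> rw [h0] <;>
      simp <;> ring

theorem exists_mem_hgl_inf_wsub {k c : ℕ} {F G : NCPoly (Fin (2 * 1))}
    (hF : F ∈ lieDeg (Fin (2 * 1)) k) (hG : G ∈ lieDeg (Fin (2 * 1)) k)
    (hFc : F ∈ countSub 1 (c + 1)) (hGc : G ∈ countSub 1 c)
    (h : ⁅letter (0 : Fin (2 * 1)), F⁆ + ⁅letter (1 : Fin (2 * 1)), G⁆ = 0) :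
    ∃ t ∈ hgl 1 k ⊓ wsub ((k : ℤ) - 2 * c) (k + 2), ∀ w l, List.ofFn w = 1 :: l → t w = cf l G := by
  have hsum : ∑ d, letter d * (![F, G] : Fin (2 * 1) → NCPoly (Fin (2 * 1))) d =
      letter 0 * F + letter 1 * G := Fin.sum_univ_two _
  refine ⟨tensorOf 1 (k + 2) (∑ d, letter d * (![F, G] : Fin (2 * 1) → _) d),
    ⟨tensorOf_mem_hgl (fun d => ?_) ((Fin.sum_univ_two _).trans h), fun w hw => ?_⟩, fun w l hl => ?_⟩
  · fin_cases d
    · exact hF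
    · exact hG
  · have h0 := mul_mem_countSub (letter_mem_countSub 0 1) hFc
    have h1 := mul_mem_countSub (letter_mem_countSub 1 1) hGc
    rw [if_neg (by decide), zero_add] at h0
    rw [if_pos rfl, add_comm] at h1
    rw [hsum]
    refine add_mem h0 h1 _ fun hc => hw ?_
    rw [wtW_eq, hc]
    push_cast
    ring
  · rw [hsum, tensorOf_apply, hl]
    simp

end Tensors

/-! ## Dimension count -/

theorem finrank_eq_of_triangular {V : Type*} [AddCommGroup V] [Module ℚ V] {N : ℕ}
    (φ : V →ₗ[ℚ] Fin N → ℚ) (hφ : Function.Injective φ) (v : Fin N → V)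
    (hv : ∀ j i, i < j → φ (v j) i = 0) (hv' : ∀ i, φ (v i) i ≠ 0) : Module.finrank ℚ V = N := by
  have : Module.Finite ℚ V := Module.Finite.of_injective φ hφ
  have hdet : (Matrix.of fun j => φ (v j)).det ≠ 0 := by
    rw [Matrix.det_of_isUpperTriangular (M := Matrix.of fun j => φ (v j)) fun j i hij => hv j i hij]
    exact Finset.prod_ne_zero_iff.2 fun i _ => hv' i
  have hli : LinearIndependent ℚ v :=
    LinearIndependent.of_comp φ (Matrix.linearIndependent_rows_of_det_ne_zero hdet)
  refine le_antisymm ?_ ?_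
  · simpa using LinearMap.finrank_le_finrank_of_injective hφ
  · simpa using hli.fintype_card_le_finrank

section LeadingTerm

open NCPoly

theorem eq_zero_of_apply_eq_zero {k c : ℕ} {m : ℤ} (hm : m = (k : ℤ) + 2 - 2 * c)
    {t : Tens 1 (k + 2)} (ht : t ∈ wsub m (k + 2))
    (h : ∀ w, (List.ofFn w).count 1 = c → t w = 0) : t = 0 := by
  funext w
  by_cases hw : (List.ofFn w).count 1 = c
  · exact h w hw
  · refine ht w fun hwt => hw ?_
    rw [wtW_eq, hm] at hwt
    push_cast at hwt
    omega

theorem hgl_inf_wsub_eq_bot_of_count {k c : ℕ} {m : ℤ} (hm : (k : ℤ) + 2 - 2 * c < m)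
    (h : ∀ φ : List (Fin (2 * 1)) → ℚ, IsCyclicLie k φ → ∀ l, l.length = k + 2 → l.count 1 < c →
      φ l = 0) : hgl 1 k ⊓ wsub m (k + 2) = ⊥ := by
  refine (Submodule.eq_bot_iff _).2 fun t ht => ?_
  obtain ⟨φ, hφ, e⟩ := exists_isCyclicLie_of_mem_hgl ht.1
  funext w
  by_cases hw : wtW w = m
  · rw [e]
    refine h φ hφ _ (List.length_ofFn) ?_
    rw [wtW_eq] at hw
    push_cast at hw
    omega
  · exact ht.2 w hw

theorem finrank_hgl_inf_wsub_even {k : ℕ} (hk : Even k) :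
    Module.finrank ℚ ↥(hgl 1 k ⊓ wsub ((k : ℤ) - 2) (k + 2)) = 1 := by
  have hall : ∀ c : Fin (2 * 1), c = 0 ∨ c = 1 := by decide
  have hab : (0 : Fin (2 * 1)) ≠ 1 := by decide
  obtain ⟨W, hW⟩ := exists_ofFn_eq (n := k + 2) ((1 : Fin (2 * 1)) :: word₂ 0 1 0 k)
    (by simp [length_word₂])
  obtain ⟨n, rfl⟩ := hk
  obtain ⟨F, hF, hFc, h⟩ := exists_lie_add_lie_adPow_eq_zero hab n
  have hY : adPow (0 : Fin (2 * 1)) (n + n) (letter 1) ∈ lieDeg (Fin (2 * 1)) (n + n) := by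
    simpa using adPow_mem_lieDeg (0 : Fin (2 * 1)) (letter_mem_lieDeg 1) (n + n)
  obtain ⟨t, ht, ht'⟩ := exists_mem_hgl_inf_wsub hF hY hFc (adPow_letter_mem_countSub hab _) h
  rw [show ((n + n : ℕ) : ℤ) - 2 * (1 : ℕ) = (n + n : ℕ) - 2 by norm_num] at ht
  refine finrank_eq_of_triangular
    (LinearMap.pi fun _ : Fin 1 => (LinearMap.proj W) ∘ₗ Submodule.subtype _) ?_
    (fun _ => ⟨t, ht⟩) (fun j i hij => absurd hij (by omega)) fun i => ?_
  · refine (injective_iff_map_eq_zero _).2 fun s hs => Subtype.ext ?_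
    obtain ⟨φ, hφ, e⟩ := exists_isCyclicLie_of_mem_hgl s.2.1
    refine eq_zero_of_apply_eq_zero (c := 2) (by push_cast; ring) s.2.2 fun w hw => ?_
    rw [e]
    refine hφ.eq_zero_of_count_eq_two_of_top hab hall ?_ List.length_ofFn hw
    rw [← hW, ← e]
    exact congrFun hs 0
  · change t W ≠ 0
    rw [ht' W _ hW, word₂_zero, cf_cons_replicate_adPow_letter hab, if_pos rfl]
    exact pow_ne_zero _ (by norm_num)

theorem finrank_hgl_inf_wsub_odd {k : ℕ} (hk : Odd k) :
    Module.finrank ℚ ↥(hgl 1 k ⊓ wsub ((k : ℤ) - 4) (k + 2)) = k / 6 := by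
  have hall : ∀ c : Fin (2 * 1), c = 0 ∨ c = 1 := by decide
  have hab : (0 : Fin (2 * 1)) ≠ 1 := by decide
  have hWex : ∀ i : Fin (k / 6), ∃ W : Fin (k + 2) → Fin (2 * 1),
      List.ofFn W = 1 :: word₃ 0 1 (2 * i + 1) 0 (k - (2 * i + 2)) := fun i =>
    exists_ofFn_eq _ (by rw [List.length_cons, length_word₃]; omega)
  choose W hW using hWex
  have htex : ∀ i : Fin (k / 6), ∃ t ∈ hgl 1 k ⊓ wsub ((k : ℤ) - 4) (k + 2),
      ∀ w l, List.ofFn w = 1 :: l →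
        t w = cf l (tripod 0 1 (2 * i + 1) (2 * i + 2) (k - (4 * i + 4))) := by
    intro i
    obtain ⟨F, hF, hFc, h⟩ :=
      exists_lie_add_lie_tripod_eq_zero hab (2 * i + 1) (2 * i + 2) (k - (4 * i + 4))
    have hG := tripod_mem_lieDeg (0 : Fin (2 * 1)) 1 (2 * i + 1) (2 * i + 2) (k - (4 * i + 4))
    rw [show 2 * (i : ℕ) + 1 + (2 * i + 2) + (k - (4 * i + 4)) + 1 = k by omega] at hF hG
    exact exists_mem_hgl_inf_wsub (c := 2) hF hG hFc (tripod_mem_countSub hab _ _ _) h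
  choose t ht ht' using htex
  refine finrank_eq_of_triangular
    (LinearMap.pi fun i => (LinearMap.proj (W i)) ∘ₗ Submodule.subtype _) ?_
    (fun i => ⟨t i, ht i⟩) (fun j i hij => ?_) fun i => ?_
  · refine (injective_iff_map_eq_zero _).2 fun s hs => Subtype.ext ?_
    obtain ⟨φ, hφ, e⟩ := exists_isCyclicLie_of_mem_hgl s.2.1
    refine eq_zero_of_apply_eq_zero (c := 3) (by push_cast; ring) s.2.2 fun w hw => ?_
    rw [e]
    refine hφ.eq_zero_of_count_eq_three hab hk hall (fun i hi j hij => ?_) List.length_ofFn hw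
    obtain rfl : j = k - (2 * i + 2) := by omega
    have hWi := hW ⟨i, hi⟩
    rw [← hWi, ← e]
    exact congrFun hs ⟨i, hi⟩
  · change t j (W i) = 0
    rw [ht' j _ _ (hW i), cf_word₃_tripod_eq_zero hab (by omega) (by omega)]
    have : (i : ℕ) < j := hij
    omega
  · change t i (W i) ≠ 0
    obtain ⟨e, he⟩ := hk
    rw [ht' i _ _ (hW i),
      show k - (2 * (i : ℕ) + 2) = 2 * i + 2 + (k - (4 * i + 4)) by omega,
      cf_word₃_tripod hab (by omega) (by omega), Even.neg_one_pow ⟨(i : ℕ) + 1, by ring⟩,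
      Odd.neg_one_pow ⟨e - (2 * i + 2), by omega⟩]
    norm_num

end LeadingTerm

/-- **Statement 18** (Proposition 8.2 (i)): the leading terms of `h_{1,1}(k)` as an
`SL(2,ℚ)`-module, expressed through weight subspaces:
`h_{1,1}(k) = 0` for `k = 1,3,5`; for even `k` the top weight is `k-2` with
multiplicity `1`; for odd `k ≥ 7` the top weight is `k-4` with multiplicity `⌊k/6⌋`. -/
theorem genus_one_leading_term :
    (∀ k ∈ ({1, 3, 5} : Set ℕ), hgl 1 k = ⊥) ∧
    (∀ k : ℕ, 2 ≤ k → k % 2 = 0 →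
      (∀ m : ℤ, (k:ℤ) - 2 < m → hgl 1 k ⊓ wsub m (k+2) = ⊥) ∧
      Module.finrank ℚ ↥(hgl 1 k ⊓ wsub ((k:ℤ)-2) (k+2)) = 1) ∧
    (∀ k : ℕ, 7 ≤ k → k % 2 = 1 →
      (∀ m : ℤ, (k:ℤ) - 4 < m → hgl 1 k ⊓ wsub m (k+2) = ⊥) ∧
      Module.finrank ℚ ↥(hgl 1 k ⊓ wsub ((k:ℤ)-4) (k+2)) = k / 6) := by
  have hall : ∀ c : Fin (2 * 1), c = 0 ∨ c = 1 := by decide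
  have hab : (0 : Fin (2 * 1)) ≠ 1 := by decide
  refine ⟨fun k hk => ?_, fun k hk hk' => ⟨fun m hm => ?_, ?_⟩, fun k hk hk' => ⟨fun m hm => ?_, ?_⟩⟩
  · have hk' : Odd k ∧ k < 6 := by
      rcases hk with rfl | rfl | rfl <;> decide
    refine (Submodule.eq_bot_iff _).2 fun t ht => funext fun w => ?_
    obtain ⟨φ, hφ, e⟩ := exists_isCyclicLie_of_mem_hgl ht
    rw [e]
    exact hφ.eq_zero_of_odd_of_lt hab hk'.1 hk'.2 hall List.length_ofFn
  · exact hgl_inf_wsub_eq_bot_of_count (c := 2) (by push_cast; linarith) fun φ hφ l hl hc =>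
      hφ.eq_zero_of_count_le_one hab (by omega) hall hl (by omega)
  · exact finrank_hgl_inf_wsub_even (Nat.even_iff.2 hk')
  · refine hgl_inf_wsub_eq_bot_of_count (c := 3) (by push_cast; linarith) fun φ hφ l hl hc => ?_
    by_cases h : l.count 1 = 2
    · exact hφ.eq_zero_of_count_eq_two_of_odd (Nat.odd_iff.2 hk') hall hl h
    · exact hφ.eq_zero_of_count_le_one hab (by omega) hall hl (by omega)
  · exact finrank_hgl_inf_wsub_odd (Nat.odd_iff.2 hk')
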